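/- Let q be a power of an odd prime and let K = F_q(x) be the rational function field over F_q in the variable x. Then the Galois group over K of the polynomial Y^{q−1} + Y + 2x ∈ K[Y] has cardinality (q−1)!, i.e. it is the full symmetric group S_{q−1}. -/

import Mathlib

open Polynomial

lemma irr_aux {F : Type*} [Field F] (Q : F[X][X]) (κ : F) (hκ : κ ≠ 0)
    (h0 : Q.map (evalRingHom (0:F)) = 1) (hl : Q.leadingCoeff = C κ * X) : Irreducible Q := by
  have hQ : Q ≠ 0 := by
    rintro rfl; simp at h0
  have key : ∀ A B : F[X][X], Q = A * B → ¬ (X ∣ B.leadingCoeff) → IsUnit B := by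
    intro A B hAB hB
    have hB0 : B.map (evalRingHom (0:F)) ≠ 0 := by
      intro h
      rw [hAB, Polynomial.map_mul, h, mul_zero] at h0
      exact zero_ne_one h0
    have hu : IsUnit (B.map (evalRingHom (0:F))) := by
      rw [hAB, Polynomial.map_mul] at h0
      exact IsUnit.of_mul_eq_one_right _ h0
    have hd : (B.map (evalRingHom (0:F))).natDegree = B.natDegree := by
      apply natDegree_map_of_leadingCoeff_ne_zero
      intro h
      apply hB
      rw [X_dvd_iff, coeff_zero_eq_eval_zero]
      exact h
    rw [natDegree_eq_zero_of_isUnit hu] at hd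
    obtain ⟨b, rfl⟩ : ∃ b, C b = B := ⟨_, (eq_C_of_natDegree_eq_zero hd.symm).symm⟩
    rw [leadingCoeff_C] at hB
    have h1 : b ∣ C κ * X := by
      rw [← hl, hAB, leadingCoeff_mul, leadingCoeff_C]
      exact dvd_mul_left _ _
    have h2 : b ∣ X := (IsUnit.dvd_mul_left (isUnit_C.2 hκ.isUnit)).1 h1
    rcases (irreducible_X (R := F)).dvd_iff.1 h2 with h | h
    · exact isUnit_C.2 h
    · exact absurd h.symm.dvd (fun hh => hB (h.dvd))
  refine ⟨?_, ?_⟩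
  · intro hu
    have := natDegree_eq_zero_of_isUnit hu
    obtain ⟨b, rfl⟩ : ∃ b, C b = Q := ⟨_, (eq_C_of_natDegree_eq_zero this).symm⟩
    rw [leadingCoeff_C] at hl
    subst hl
    simp at h0
  · intro A B hAB
    by_cases hB : X ∣ B.leadingCoeff
    · left
      refine key B A (by rw [hAB, mul_comm]) ?_
      intro hA
      have h1 : (X:F[X])*X ∣ C κ * X := by
        rw [← hl, hAB, leadingCoeff_mul]; exact mul_dvd_mul hA hB
      have h2 := (mul_dvd_mul_iff_right (X_ne_zero (R := F))).1 h1
      exact not_isUnit_X (isUnit_of_dvd_unit h2 (isUnit_C.2 hκ.isUnit))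
    · right; exact key A B hAB hB

/-- the polynomial whose vanishing describes pairs of distinct roots -/
noncomputable def gpoly (F : Type*) [Field F] [Fintype F] [DecidableEq F] : F[X][X] :=
  ∏ c ∈ Finset.univ \ {(0:F), 1}, (X - C (C c * X)) + 1

lemma gpoly_card (F : Type*) [Field F] [Fintype F] [DecidableEq F] :
    ((Finset.univ : Finset F) \ {(0:F), 1}).card = Fintype.card F - 2 := by
  rw [Finset.card_sdiff_of_subset (Finset.subset_univ _), Finset.card_univ, Finset.card_pair zero_ne_one]

lemma gpoly_deg (F : Type*) [Field F] [Fintype F] [DecidableEq F] (h : 2 < Fintype.card F) :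
    (1 : F[X][X]).degree < (∏ c ∈ Finset.univ \ {(0:F), 1}, (X - C (C c * X : F[X]))).degree := by
  rw [degree_one, degree_prod]
  simp only [degree_X_sub_C, Finset.sum_const, gpoly_card]
  rw [nsmul_one]
  exact_mod_cast (by omega : 0 < Fintype.card F - 2)

lemma gpoly_monic (F : Type*) [Field F] [Fintype F] [DecidableEq F] (h : 2 < Fintype.card F) :
    (gpoly F).Monic :=
  (monic_prod_of_monic _ _ (fun _ _ => monic_X_sub_C _)).add_of_left (gpoly_deg F h)

lemma gpoly_trans (F : Type*) [Field F] [Fintype F] [DecidableEq F] :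
    Bivariate.swap (R := F) (algEquivAevalXAddC (-X : F[X]) (gpoly F)) =
      ∏ c ∈ (Finset.univ : Finset F) \ {(0:F), 1}, (C (C (-(1 + c))) * X + C X) + 1 := by
  rw [gpoly, map_add, map_one, map_add, map_one, map_prod, map_prod]
  congr 1
  apply Finset.prod_congr rfl
  intro c _
  have h1 : algEquivAevalXAddC (-X : F[X]) (X - C (C c * X)) = X - C X - C (C c) * C X := by
    simp [sub_eq_add_neg]
  rw [h1, map_sub, map_sub, map_mul, Bivariate.swap_X, Bivariate.swap_Y, Bivariate.swap_C_C]
  simp only [map_neg, map_add, map_one]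
  ring

lemma gpoly_irr (F : Type*) [Field F] [Fintype F] [DecidableEq F] (h2 : (2:F) ≠ 0) :
    Irreducible (gpoly F) := by
  have hone : (-1:F) ≠ 1 := by
    intro h; apply h2; linear_combination -h
  have h3 : 2 < Fintype.card F := by
    have : ({0, 1, -1} : Finset F).card = 3 := by
      rw [Finset.card_eq_three]
      exact ⟨0, 1, -1, by simp, by simp, hone.symm, rfl⟩
    have := Finset.card_le_univ ({0, 1, -1} : Finset F)
    omega
  by_cases hq : Fintype.card F = 3
  · apply (gpoly_monic F h3).irreducible_of_degree_eq_one
    rw [gpoly, degree_add_eq_left_of_degree_lt (gpoly_deg F h3), degree_prod]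
    simp only [degree_X_sub_C, Finset.sum_const, gpoly_card, hq]
    simp
  · have e1 := (MulEquiv.irreducible_iff (algEquivAevalXAddC (-X : F[X])) (x := gpoly F))
    rw [← e1]
    have e2 := (MulEquiv.irreducible_iff (Bivariate.swap (R := F))
      (x := algEquivAevalXAddC (-X : F[X]) (gpoly F)))
    rw [← e2]
    have hm : (-1:F) ∈ ((Finset.univ : Finset F) \ {(0:F), 1}) := by simp [hone]
    have hform : Bivariate.swap (R := F) (algEquivAevalXAddC (-X : F[X]) (gpoly F)) =
      C X * ∏ c ∈ ((Finset.univ : Finset F) \ {(0:F), 1}).erase (-1), (C (C (-(1 + c))) * X + C X) + 1 := by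
      rw [gpoly_trans, ← Finset.mul_prod_erase _ _ hm]
      simp
    rw [hform]
    have hlc : (C X * ∏ c ∈ ((Finset.univ : Finset F) \ {(0:F), 1}).erase (-1), (C (C (-(1 + c))) * X + C X)
        : F[X][X]).leadingCoeff = 
          C (∏ c ∈ ((Finset.univ : Finset F) \ {(0:F), 1}).erase (-1), (-(1 + c))) * X := by
      rw [leadingCoeff_mul, leadingCoeff_C, leadingCoeff_prod, mul_comm, map_prod]
      congr 1
      apply Finset.prod_congr rfl
      intro c hc
      apply leadingCoeff_linear
      simp only [Finset.mem_erase] at hc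
      intro h
      rw [C_eq_zero] at h
      exact hc.1 (by linear_combination -h)
    have hne : ∏ c ∈ ((Finset.univ : Finset F) \ {(0:F), 1}).erase (-1), (-(1 + c)) ≠ 0 := by
      rw [Finset.prod_ne_zero_iff]
      intro c hc h
      simp only [Finset.mem_erase] at hc
      exact hc.1 (by linear_combination -h)
    have hdeg : (1 : F[X][X]).degree < (C X * ∏ c ∈ ((Finset.univ : Finset F) \ {(0:F), 1}).erase (-1), (C (C (-(1 + c))) * X + C X)
        : F[X][X]).degree := by
      rw [degree_mul, degree_C X_ne_zero, zero_add, degree_prod, degree_one]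
      rw [Finset.sum_congr rfl (g := fun _ => 1)]
      · rw [Finset.sum_const, Finset.card_erase_of_mem (by simp [hone]), gpoly_card, nsmul_one]
        exact_mod_cast (by omega : 0 < Fintype.card F - 2 - 1)
      · intro c hc
        apply degree_linear
        simp only [Finset.mem_erase] at hc
        intro h
        rw [C_eq_zero] at h
        exact hc.1 (by linear_combination -h)
    apply irr_aux _ _ hne
    · simp
    · rw [leadingCoeff_add_of_degree_lt' hdeg, hlc]

lemma prod_X_sub_C_univ (F : Type*) [Field F] [Fintype F] :
    ∏ c : F, (X - C c) = X ^ Fintype.card F - X := by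
  have hm : (X ^ Fintype.card F - X : F[X]).Monic :=
    monic_X_pow_sub (by rw [degree_X]; exact_mod_cast Fintype.one_lt_card)
  have := prod_multiset_X_sub_C_of_monic_of_roots_card_eq hm (by
    rw [FiniteField.roots_X_pow_card_sub_X, FiniteField.X_pow_card_sub_X_natDegree_eq F Fintype.one_lt_card]
    rfl)
  rw [FiniteField.roots_X_pow_card_sub_X] at this
  exact this

lemma gpoly_rel {F L : Type*} [Field F] [Fintype F] [DecidableEq F] [Field L] [Algebra F L]
    (y z : L) (hy : y ≠ 0) (hz : z ≠ 0) (hyz : z ≠ y)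
    (h : z ^ (Fintype.card F - 1) + z = y ^ (Fintype.card F - 1) + y) :
    ∏ c ∈ Finset.univ \ {(0:F), 1}, (z - algebraMap F L c * y) + 1 = 0 := by
  set q := Fintype.card F with hq
  have hq1 : 1 < q := Fintype.one_lt_card
  have h1 : ∏ c : F, (z - algebraMap F L c * y) = z ^ q - z * y ^ (q-1) := by
    have := congrArg (aeval (z / y)) (prod_X_sub_C_univ F)
    simp only [map_prod, map_sub, aeval_X, aeval_C, map_pow] at this
    calc ∏ c : F, (z - algebraMap F L c * y) = ∏ c : F, (z / y - algebraMap F L c) * y := by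
          apply Finset.prod_congr rfl; intro c _; field_simp
      _ = (∏ c : F, (z / y - algebraMap F L c)) * y ^ q := by
          rw [Finset.prod_mul_distrib, Finset.prod_const, Finset.card_univ]
      _ = _ := by
          rw [this, ← hq]
          obtain ⟨m, hm⟩ : ∃ m, q = m + 1 := ⟨q - 1, by omega⟩
          rw [hm, Nat.add_sub_cancel]
          rw [div_pow]
          field_simp
          ring
  rw [← Finset.prod_sdiff (Finset.subset_univ {(0:F),1}), Finset.prod_pair zero_ne_one] at h1
  simp only [map_zero, zero_mul, sub_zero, map_one, one_mul] at h1
  obtain ⟨m, hm⟩ : ∃ m, q = m + 1 := ⟨q - 1, by omega⟩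
  rw [hm, Nat.add_sub_cancel] at h h1
  apply mul_left_cancel₀ (mul_ne_zero hz (sub_ne_zero.2 hyz))
  rw [mul_zero]
  linear_combination h1 + z * h

lemma exists_aut {K M L : Type*} [Field K] [Field M] [Field L] [Algebra K L] [Normal K L]
    (i : K →+* M) (j : M →+* L) (hij : j.comp i = algebraMap K L) (g : M[X]) (hg : Irreducible g)
    (z z' : L) (hz : g.eval₂ j z = 0) (hz' : g.eval₂ j z' = 0) :
    ∃ σ : L ≃ₐ[K] L, σ z = z' ∧ ∀ m, σ (j m) = j m := by
  let := i.toAlgebra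
  let := j.toAlgebra
  have : IsScalarTower K M L := IsScalarTower.of_algebraMap_eq' hij.symm
  have : Normal M L := Normal.tower_top_of_normal K M L
  have e : minpoly M z = minpoly M z' := by
    rw [← minpoly.eq_of_irreducible hg hz, ← minpoly.eq_of_irreducible hg hz']
  obtain ⟨σ, hσ⟩ := minpoly.exists_algEquiv_of_root' (K := M) (x := z') (y := z)
    (Algebra.IsAlgebraic.isAlgebraic z) (by rw [e]; exact minpoly.aeval _ _)
  exact ⟨σ.restrictScalars K, hσ, fun m => σ.commutes m⟩

lemma surj_of_twotrans {G Ω : Type*} [Group G] [MulAction G Ω] [Finite Ω] [DecidableEq Ω]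
    (h2 : ∀ a b c d : Ω, a ≠ b → c ≠ d → ∃ g : G, g • a = c ∧ g • b = d)
    (g : G) (hg : (MulAction.toPermHom G Ω g).IsSwap) :
    Function.Surjective (MulAction.toPermHom G Ω) := by
  rw [← MonoidHom.range_eq_top, eq_top_iff, ← Equiv.Perm.closure_isSwap, Subgroup.closure_le]
  rintro _ ⟨c, d, hcd, rfl⟩
  obtain ⟨a, b, hab, h⟩ := hg
  obtain ⟨k, rfl, rfl⟩ := h2 a b c d hab hcd
  refine ⟨k * g * k⁻¹, ?_⟩
  rw [map_mul, map_mul, h, map_inv]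
  have := Equiv.swap_apply_apply (MulAction.toPermHom G Ω k) a b
  exact this.symm

lemma deg_aux {R : Type*} [CommRing R] [Nontrivial R] (n : ℕ) (hn : 2 ≤ n) (c : R) :
    (X + C c : R[X]).degree < n := by
  rw [degree_X_add_C]
  exact_mod_cast (by omega : 1 < n)

lemma natDegree_aux {R : Type*} [CommRing R] [Nontrivial R] (n : ℕ) (hn : 2 ≤ n) (c : R) :
    (X ^ n + X + C c : R[X]).natDegree = n := by
  rw [add_assoc]
  apply natDegree_eq_of_degree_eq_some
  rw [degree_add_eq_left_of_degree_lt, degree_X_pow]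
  rw [degree_X_pow]
  exact deg_aux n hn c

lemma count_aux {k : Type*} [Field k] (m : ℕ) (hm : 1 ≤ m) (hm0 : ((m + 2 : ℕ) : k) = 0)
    (h2 : (2:k) ≠ 0)
    (g : k[X]) (hg : g = X ^ (m + 1) + X + C (-2)) (hs : g.Splits) :
    m + 1 ≤ (g.rootSet k).ncard + 1 := by
  classical
  have hdeg : g.natDegree = m + 1 := by
    rw [hg]; exact natDegree_aux _ (by omega) _
  have hg0 : g ≠ 0 := by rintro rfl; simp at hdeg
  have hc : (m:k) = -2 := by push_cast at hm0; linear_combination hm0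
  have hd : derivative g = - X ^ m + 1 := by
    rw [hg]
    simp [hc]
    rw [show (C 2 : k[X]) = 2 from map_ofNat C 2]
    ring
  have hd2 : derivative (derivative g) = C 2 * X ^ (m - 1) := by
    rw [hd, derivative_add, derivative_neg, derivative_X_pow, hc]
    simp
  have h1 : ∀ r, r ≠ 1 → rootMultiplicity r g ≤ 1 := by
    intro r hr
    by_contra! h
    rw [one_lt_rootMultiplicity_iff_isRoot hg0, hd] at h
    obtain ⟨ha, hb⟩ := h
    simp [hg] at ha hb
    apply hr
    apply mul_left_cancel₀ h2
    rw [pow_succ] at ha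
    linear_combination ha + r * hb
  have h1' : rootMultiplicity 1 g ≤ 2 := by
    by_contra! h
    rw [lt_rootMultiplicity_iff_isRoot_iterate_derivative_of_mem_nonZeroDivisors hg0
      (by simpa using h2)] at h
    have := h 2 le_rfl
    simp [hd2] at this
    exact h2 this
  have hcard : g.roots.card = m + 1 := by rw [← hs.natDegree_eq_card_roots, hdeg]
  rw [rootSet_def, Set.ncard_coe_finset, aroots_def, Algebra.algebraMap_self, Polynomial.map_id,
    ← hcard, ← Multiset.toFinset_sum_count_eq]
  calc _ ≤ ∑ r ∈ g.roots.toFinset, (1 + if r = 1 then 1 else 0) := by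
        apply Finset.sum_le_sum
        intro r _
        rw [count_roots]
        split_ifs with h
        · subst h; exact h1'
        · exact h1 r h
    _ ≤ _ := by
        rw [Finset.sum_add_distrib, Finset.sum_ite_eq', Finset.card_eq_sum_ones]
        split_ifs <;> omega

noncomputable def fR (F : Type*) [Field F] (n : ℕ) : F[X][X] := X ^ n + X + C (2 * X)

lemma fR_monic (F : Type*) [Field F] (n : ℕ) (hn : 2 ≤ n) : (fR F n).Monic := by
  rw [fR, add_assoc]
  exact monic_X_pow_add (deg_aux n hn _)

lemma fR_natDegree (F : Type*) [Field F] (n : ℕ) (hn : 2 ≤ n) : (fR F n).natDegree = n := by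
  rw [fR]; exact natDegree_aux n hn _

lemma fR_irr (F : Type*) [Field F] (n : ℕ) (h2 : (2:F) ≠ 0) : Irreducible (fR F n) := by
  rw [← MulEquiv.irreducible_iff (Bivariate.swap (R := F))]
  have h : Bivariate.swap (fR F n) = C (C 2) * (X - C (C (-2⁻¹) * (X ^ n + X))) := by
    have e : (fR F n) = X ^ n + X + C (C 2) * C X := by
      simp only [fR, map_mul, map_ofNat]
    rw [e, map_add, map_add, map_pow, map_mul, Bivariate.swap_X, Bivariate.swap_Y,
      Bivariate.swap_C_C]
    rw [mul_sub, ← C_mul, ← mul_assoc, ← C_mul, mul_neg, mul_inv_cancel₀ h2]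
    simp only [map_add, map_pow, map_mul, map_neg, map_one]
    ring
  rw [h, irreducible_isUnit_mul]
  · exact irreducible_X_sub_C _
  · exact isUnit_C.2 (isUnit_C.2 h2.isUnit)

lemma fK_eq (F : Type*) [Field F] (n : ℕ) : (fR F n).map (algebraMap F[X] (RatFunc F)) =
    X ^ n + X + C (2 * RatFunc.X) := by
  simp only [fR, Polynomial.map_add, Polynomial.map_pow, map_X, Polynomial.map_C]
  rw [RingHom.map_mul (algebraMap F[X] (RatFunc F)), RatFunc.algebraMap_X, map_ofNat (algebraMap F[X] (RatFunc F)) 2]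

section
variable {F : Type*} [Field F] [Fintype F] {L : Type*} [Field L] [Algebra (RatFunc F) L]
  [Algebra F L] [IsScalarTower F (RatFunc F) L]

lemma xL_trans : Transcendental F (algebraMap (RatFunc F) L RatFunc.X) := by
  intro h
  rw [isAlgebraic_algebraMap_iff (FaithfulSMul.algebraMap_injective _ _)] at h
  exact RatFunc.transcendental_X h

noncomputable def liftX {F L : Type*} [Field F] [Field L] [Algebra F L] (y : L)
    (hy : Transcendental F y) : RatFunc F →ₐ[F] L :=
  RatFunc.liftAlgHom (aeval y) (by
    intro a ha
    rw [Submonoid.mem_comap, mem_nonZeroDivisors_iff_ne_zero]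
    rw [mem_nonZeroDivisors_iff_ne_zero] at ha
    exact fun h => hy ⟨a, ha, h⟩)

lemma liftX_algebraMap {F L : Type*} [Field F] [Field L] [Algebra F L] (y : L)
    (hy : Transcendental F y) (a : F[X]) : liftX y hy (algebraMap _ _ a) = aeval y a := by
  simp [liftX, RatFunc.liftAlgHom_apply]

lemma liftX_X {F L : Type*} [Field F] [Field L] [Algebra F L] (y : L)
    (hy : Transcendental F y) : liftX y hy RatFunc.X = y := by
  rw [← RatFunc.algebraMap_X, liftX_algebraMap, aeval_X]

lemma twotrans_aux (h2 : (2:F) ≠ 0) [Normal (RatFunc F) L] (y z z' : L)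
    (hy : y ^ (Fintype.card F - 1) + y + 2 * algebraMap (RatFunc F) L RatFunc.X = 0)
    (hz : z ^ (Fintype.card F - 1) + z + 2 * algebraMap (RatFunc F) L RatFunc.X = 0)
    (hz' : z' ^ (Fintype.card F - 1) + z' + 2 * algebraMap (RatFunc F) L RatFunc.X = 0)
    (hyz : z ≠ y) (hyz' : z' ≠ y) : ∃ σ : L ≃ₐ[RatFunc F] L, σ z = z' ∧ σ y = y := by
  classical
  have h2L : (2:L) ≠ 0 := by
    have := (map_ne_zero (algebraMap F L)).2 h2
    rwa [map_ofNat (algebraMap F L) 2] at this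
  have hn : Fintype.card F - 1 ≠ 0 := by
    have : 1 < Fintype.card F := Fintype.one_lt_card
    omega
  set x := algebraMap (RatFunc F) L RatFunc.X with hx
  have hx0 : x ≠ 0 := by
    intro h
    apply xL_trans (F := F) (L := L)
    rw [← hx, h]
    exact isAlgebraic_zero
  have hne : ∀ w : L, w ^ (Fintype.card F - 1) + w + 2 * x = 0 → w ≠ 0 := by
    rintro w hw rfl
    rw [zero_pow hn] at hw
    simp [h2L, hx0] at hw
  have hxy : x = aeval y (C (-2⁻¹ : F) * (X ^ (Fintype.card F - 1) + X)) := by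
    simp only [map_mul, aeval_C, map_neg, map_inv₀, map_add, map_pow, aeval_X]
    rw [map_ofNat (algebraMap F L) 2]
    field_simp
    linear_combination hy
  have hyt : Transcendental F y := by
    intro h
    apply xL_trans (F := F) (L := L)
    rw [← hx, hxy]
    simp only [map_mul, aeval_C, map_add, map_pow, aeval_X]
    have h' : IsAlgebraic F y := h
    exact (isAlgebraic_algebraMap _).mul ((h'.pow _).add h')
  let j := liftX y hyt
  let t : RatFunc F := algebraMap F[X] _ (C (-2⁻¹ : F) * (X ^ (Fintype.card F - 1) + X))
  have hjt : j t = x := by rw [liftX_algebraMap, hxy]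
  have htt : Transcendental F t := by
    intro h
    apply xL_trans (F := F) (L := L)
    rw [← hx, ← hjt]
    exact h.algHom j
  let i := liftX t htt
  have hij : (j : RatFunc F →+* L).comp (i : RatFunc F →+* RatFunc F) = algebraMap (RatFunc F) L := by
    apply IsLocalization.ringHom_ext (nonZeroDivisors F[X])
    apply Polynomial.ringHom_ext
    · intro a
      have : algebraMap F[X] (RatFunc F) (C a) = algebraMap F _ a := by
        rw [RatFunc.algebraMap_C]; rfl
      simp only [RingHom.comp_apply, this, RingHom.coe_coe, AlgHom.commutes]
      rw [← IsScalarTower.algebraMap_apply]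
    · simp only [RingHom.comp_apply, RatFunc.algebraMap_X, RingHom.coe_coe, ← hx]
      rw [liftX_X, hjt]
  have hcard : 2 < Fintype.card F := by
    by_contra! h
    have h1 : 1 < Fintype.card F := Fintype.one_lt_card
    have : Fintype.card F = 2 := by omega
    have := FiniteField.cast_card_eq_zero F
    simp_all
  have hgirr : Irreducible ((gpoly F).map (algebraMap F[X] (RatFunc F))) :=
    ((gpoly_monic F hcard).irreducible_iff_irreducible_map_fraction_map).1 (gpoly_irr F h2)
  have hroot : ∀ w : L, w ^ (Fintype.card F - 1) + w + 2 * x = 0 → w ≠ y →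
      ((gpoly F).map (algebraMap F[X] (RatFunc F))).eval₂ (j : RatFunc F →+* L) w = 0 := by
    intro w hw hwy
    rw [eval₂_map]
    have hc : (j : RatFunc F →+* L).comp (algebraMap F[X] (RatFunc F)) = (aeval y : F[X] →ₐ[F] L) := by
      ext a
      · simp only [RingHom.comp_apply, j, RingHom.coe_coe, liftX_algebraMap]
      · simp [RingHom.comp_apply, j, liftX_X]
    rw [hc, gpoly, eval₂_add, eval₂_one, eval₂_finsetProd]
    have := gpoly_rel (F := F) y w (hne y hy) (hne w hw) hwy (by linear_combination hw - hy)
    rw [← this]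
    congr 1
    apply Finset.prod_congr rfl
    intro c _
    simp
  obtain ⟨σ, h1, h3⟩ := exists_aut (i : RatFunc F →+* RatFunc F) (j : RatFunc F →+* L) hij _ hgirr
    z z' (hroot z hz hyz) (hroot z' hz' hyz')
  refine ⟨σ, h1, ?_⟩
  have := h3 RatFunc.X
  simpa [j, liftX_X] using this
end

lemma exists_inertia {R S : Type*} (G : Type*) [CommRing R] [IsDedekindDomain R] [CommRing S]
    [IsDedekindDomain S] [Algebra R S]
    [Module.Finite R S] [Module.IsTorsionFree R S] [Group G] [Finite G] [MulSemiringAction G S]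
    [IsGaloisGroup G R S] (p : Ideal R) [p.IsMaximal] [Finite (R ⧸ p)] (hp : p ≠ ⊥)
    (P : Ideal S) [P.IsPrime] [P.LiesOver p] (h : p.map (algebraMap R S) ≤ P ^ 2) :
    ∃ g : G, g ∈ P.inertia G ∧ g ≠ 1 := by
  have : Finite p.ResidueField :=
    Finite.of_surjective _ (Ideal.bijective_algebraMap_quotient_residueField p).2
  have hc := Ideal.card_inertia_eq_ramificationIdxIn (G := G) p P
  rw [Ideal.ramificationIdxIn_eq_ramificationIdx p P G] at hc
  have h1 : P.ramificationIdx R ≠ 1 := by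
    rw [← Ideal.ramificationIdx'_eq_ramificationIdx p P hp]
    rw [Ideal.ramificationIdx'_ne_one_iff (h.trans (Ideal.pow_le_self two_ne_zero))]
    exact h
  rw [← hc] at h1
  have h2 : P.inertia G ≠ ⊥ := by
    intro h
    apply h1
    rw [h]
    simp
  rw [← Subgroup.nontrivial_iff_ne_bot, Subgroup.nontrivial_iff_exists_ne_one] at h2
  exact h2

lemma sq_aux {S : Type*} [CommRing S] (m : ℕ) (hm : ((m + 2 : ℕ) : S) = 0) (P : Ideal S) (y : S)
    (hy : y - 1 ∈ P) : y ^ (m + 1) + y - 2 ∈ P ^ 2 := by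
  have h1 : y ^ (m + 1) + y - 2 = (y - 1) * ∑ i ∈ Finset.range (m + 1), (y ^ i - 1) := by
    rw [Finset.sum_sub_distrib, mul_sub, mul_geom_sum]
    simp only [Finset.sum_const, Finset.card_range, nsmul_eq_mul, mul_one]
    push_cast at hm ⊢
    linear_combination (1 - y) * hm + (y - 1) * hm * 2
  rw [h1, pow_two]
  apply Ideal.mul_mem_mul hy
  apply Ideal.sum_mem
  intro i _
  have : y - 1 ∣ y ^ i - 1 := by simpa using sub_dvd_pow_sub_pow y 1 i
  exact Ideal.mem_of_dvd _ this hy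

lemma exists_isSwap_aux {F S : Type*} (G : Type*) [Field F] [Fintype F] [CommRing S] [IsDedekindDomain S]
    [Algebra F[X] S] [Module.Finite F[X] S] [Module.IsTorsionFree F[X] S] [Group G] [Finite G]
    [MulSemiringAction G S] [SMulCommClass G F[X] S]
    [IsGaloisGroup G F[X] S] (m : ℕ) (hm : 1 ≤ m) (hcard : Fintype.card F = m + 2)
    (h2 : (2:F) ≠ 0) (hs : ((fR F (m + 1)).map (algebraMap F[X] S)).Splits)
    [DecidableEq ((fR F (m + 1)).rootSet S)]
    (hinj : Function.Injective (MulAction.toPermHom G ((fR F (m + 1)).rootSet S))) :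
    ∃ g : G, (MulAction.toPermHom G ((fR F (m + 1)).rootSet S) g).IsSwap := by
  have hmF : ((m + 2 : ℕ) : F) = 0 := by rw [← hcard]; exact FiniteField.cast_card_eq_zero F
  let φ : F →+* S := (algebraMap F[X] S).comp C
  have hmS : ((m + 2 : ℕ) : S) = 0 := by
    rw [← map_natCast φ, hmF, map_zero]
  have h2S : IsUnit (2 : S) := by
    rw [← map_ofNat φ 2]; exact h2.isUnit.map φ
  let p : Ideal F[X] := Ideal.span {X - C (-1)}
  have hpmax : p.IsMaximal := PrincipalIdealRing.isMaximal_of_irreducible (irreducible_X_sub_C _)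
  have : Finite (F[X] ⧸ p) := Finite.of_equiv F (quotientSpanXSubCAlgEquiv (-1 : F)).symm.toEquiv
  have hp0 : p ≠ ⊥ := by
    intro h
    rw [Ideal.span_singleton_eq_bot] at h
    exact X_sub_C_ne_zero _ h
  obtain ⟨⟨P, hP, hPp⟩⟩ := p.nonempty_primesOver (S := S)
  have hPmax : P.IsMaximal := Ideal.IsMaximal.of_liesOver_isMaximal P p
  set x : S := algebraMap F[X] S X with hx
  have hxP : x + 1 ∈ P := by
    have h1 : (X - C (-1) : F[X]) ∈ P.under F[X] := by
      rw [← hPp.over]; exact Ideal.mem_span_singleton_self _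
    rw [Ideal.mem_comap] at h1
    simpa [hx] using h1
  have hmonic := (fR_monic F (m + 1) (by omega)).map (algebraMap F[X] S)
  have hmap : (fR F (m + 1)).map (algebraMap F[X] S) = X ^ (m + 1) + X + C (2 * x) := by
    simp only [fR, Polynomial.map_add, Polynomial.map_pow, map_X, Polynomial.map_C]
    rw [RingHom.map_mul (algebraMap F[X] S), map_ofNat (algebraMap F[X] S) 2]
  obtain ⟨y, hy, hyP⟩ : ∃ y : S, y ^ (m + 1) + y + 2 * x = 0 ∧ y - 1 ∈ P := by
    have h1 := congrArg (eval 1) (hs.eq_prod_roots_of_monic hmonic)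
    rw [eval_multiset_prod, Multiset.map_map] at h1
    have h3 : eval 1 ((fR F (m + 1)).map (algebraMap F[X] S)) ∈ P := by
      rw [hmap]
      have : eval 1 (X ^ (m + 1) + X + C (2 * x)) = 2 * (x + 1) := by
        simp only [eval_add, eval_pow, eval_X, eval_C, one_pow]; ring
      rw [this]
      exact P.mul_mem_left _ hxP
    rw [h1, hP.multiset_prod_mem_iff_exists_mem] at h3
    obtain ⟨_, h4, h5⟩ := h3
    rw [Multiset.mem_map] at h4
    obtain ⟨y, hy, rfl⟩ := h4
    refine ⟨y, ?_, ?_⟩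
    · have := isRoot_of_mem_roots hy
      rw [hmap, IsRoot] at this
      simpa using this
    · rw [← neg_mem_iff]
      simpa using h5
  have hsq : p.map (algebraMap F[X] S) ≤ P ^ 2 := by
    rw [Ideal.map_span, Ideal.span_le, Set.image_singleton, Set.singleton_subset_iff]
    have h1 := sq_aux m hmS P y hyP
    have h3 : 2 * (x + 1) ∈ P ^ 2 := by
      rw [← neg_mem_iff]
      convert h1 using 1
      linear_combination - hy
    have h4 := (Ideal.unit_mul_mem_iff_mem _ h2S).1 h3
    simpa [hx] using h4
  obtain ⟨g, hg, hg1⟩ := exists_inertia G p hp0 P hsq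
  refine ⟨g, (hs.toPermHom_apply_eq_one_or_isSwap_of_ncard_le_of_mem_inertia P ?_ g hg).resolve_left ?_⟩
  · let := Ideal.Quotient.field P
    have hle : ((fR F (m + 1)).rootSet S).ncard ≤ m + 1 := by
      classical
      rw [rootSet_def, Set.ncard_coe_finset]
      refine (Multiset.toFinset_card_le _).trans ((card_roots' _).trans (natDegree_map_le.trans ?_))
      rw [fR_natDegree F (m + 1) (by omega)]
    refine hle.trans ?_
    have hxk : Ideal.Quotient.mk P x = -1 := by
      have := Ideal.Quotient.eq_zero_iff_mem.2 hxP
      rw [map_add, map_one] at this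
      linear_combination this
    have := count_aux (k := S ⧸ P) m hm
      (by rw [← map_natCast (Ideal.Quotient.mk P), hmS, map_zero])
      (by rw [← map_ofNat (Ideal.Quotient.mk P) 2]; exact (h2S.map _).ne_zero)
      (((fR F (m + 1)).map (algebraMap F[X] S)).map (Ideal.Quotient.mk P))
      (by
        rw [hmap]
        simp only [Polynomial.map_add, Polynomial.map_pow, map_X, Polynomial.map_C]
        rw [RingHom.map_mul (Ideal.Quotient.mk P), hxk, map_ofNat (Ideal.Quotient.mk P) 2, mul_neg, mul_one])
      (hs.map _)
    refine this.trans (le_of_eq ?_)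
    congr 2
    classical
    rw [rootSet_def, rootSet_def, aroots_def, aroots_def, Algebra.algebraMap_self, Polynomial.map_id,
      Polynomial.map_map]
    rfl
  · intro h
    exact hg1 (hinj (h.trans (map_one _).symm))

lemma main_aux {F : Type*} (L : Type*) [Field F] [Fintype F] [Field L] [Algebra (RatFunc F) L]
    [Algebra F[X] L] [Algebra F L] [IsScalarTower F[X] (RatFunc F) L] [IsScalarTower F (RatFunc F) L]
    (m : ℕ) (hm : 1 ≤ m) (hcard : Fintype.card F = m + 2) (h2 : (2:F) ≠ 0)
    [IsSplittingField (RatFunc F) L ((fR F (m + 1)).map (algebraMap F[X] (RatFunc F)))] :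
    Nat.card (L ≃ₐ[RatFunc F] L) = (m + 1).factorial := by
  classical
  set f := (fR F (m + 1)).map (algebraMap F[X] (RatFunc F)) with hf
  have hmonic := fR_monic F (m + 1) (by omega)
  have hirr : Irreducible f :=
    (hmonic.irreducible_iff_irreducible_map_fraction_map).1 (fR_irr F (m + 1) h2)
  have hmK : ((m + 2 : ℕ) : RatFunc F) = 0 := by
    rw [← hcard, ← map_natCast (algebraMap F (RatFunc F)), FiniteField.cast_card_eq_zero F, map_zero]
  have hsep : f.Separable := by
    rw [separable_iff_derivative_ne_zero hirr, hf, fK_eq]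
    intro h
    have h3 := congrArg (eval 0) h
    simp [show m ≠ 0 by omega] at h3
  have : IsGalois (RatFunc F) L := IsGalois.of_separable_splitting_field hsep
  have : FiniteDimensional (RatFunc F) L := IsSplittingField.finiteDimensional L f
  let S := integralClosure F[X] L
  have : IsDedekindDomain S := IsIntegralClosure.isDedekindDomain F[X] (RatFunc F) L S
  have : Module.Finite F[X] S := IsIntegralClosure.finite F[X] (RatFunc F) L S
  have : IsFractionRing S L := IsIntegralClosure.isFractionRing_of_finite_extension F[X] (RatFunc F) L S
  have : IsGaloisGroup (L ≃ₐ[RatFunc F] L) F[X] S := 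
    IsGaloisGroup.of_isFractionRing _ F[X] S (RatFunc F) L
  have hfaith : FaithfulSMul F[X] L := by
    rw [faithfulSMul_iff_algebraMap_injective, IsScalarTower.algebraMap_eq F[X] (RatFunc F) L]
    exact (algebraMap (RatFunc F) L).injective.comp (IsFractionRing.injective F[X] (RatFunc F))
  have : Module.IsTorsionFree F[X] L := inferInstance
  have : Module.IsTorsionFree F[X] S := inferInstance
  have hinjS : Function.Injective (algebraMap S L) := Subtype.val_injective
  have hmapL : ((fR F (m + 1)).map (algebraMap F[X] S)).map (algebraMap S L) =
      f.map (algebraMap (RatFunc F) L) := by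
    rw [hf, Polynomial.map_map, Polynomial.map_map, ← IsScalarTower.algebraMap_eq,
      ← IsScalarTower.algebraMap_eq]
  have hsL : (f.map (algebraMap (RatFunc F) L)).Splits := IsSplittingField.splits L f
  have hmemL : ∀ w : L, w ∈ f.rootSet L ↔
      w ^ (m + 1) + w + 2 * algebraMap (RatFunc F) L RatFunc.X = 0 := by
    intro w
    rw [mem_rootSet, and_iff_right hirr.ne_zero, hf, fK_eq]
    simp only [map_add, map_pow, aeval_X, aeval_C]
    rw [RingHom.map_mul (algebraMap (RatFunc F) L), map_ofNat (algebraMap (RatFunc F) L) 2]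
  have hint : ∀ w ∈ f.rootSet L, IsIntegral F[X] w := by
    intro w hw
    refine ⟨fR F (m + 1), hmonic, ?_⟩
    rw [mem_rootSet] at hw
    have := hw.2
    rwa [hf, aeval_def, eval₂_map, ← IsScalarTower.algebraMap_eq] at this
  have hs : ((fR F (m + 1)).map (algebraMap F[X] S)).Splits := by
    refine Splits.of_splits_map_of_injective (i := algebraMap S L) hinjS (by rw [hmapL]; exact hsL) ?_
    intro a ha
    rw [hmapL] at ha
    have : a ∈ f.rootSet L := by rw [rootSet_def, Finset.mem_coe, Multiset.mem_toFinset]; exact ha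
    exact ⟨⟨a, hint a this⟩, rfl⟩
  have hmemS : ∀ w : S, w ∈ (fR F (m + 1)).rootSet S ↔ (w : L) ∈ f.rootSet L := by
    intro w
    rw [mem_rootSet', mem_rootSet, and_iff_right hirr.ne_zero,
      and_iff_right ((hmonic.map _).ne_zero), hf, aeval_def, aeval_def, eval₂_map,
      ← IsScalarTower.algebraMap_eq]
    rw [← hinjS.eq_iff, hom_eval₂, ← IsScalarTower.algebraMap_eq, map_zero]
    rfl
  let e : (fR F (m + 1)).rootSet S ≃ f.rootSet L :=
    { toFun := fun w => ⟨w.1.1, (hmemS _).1 w.2⟩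
      invFun := fun w => ⟨⟨w.1, hint _ w.2⟩, (hmemS _).2 w.2⟩
      left_inv := fun _ => rfl
      right_inv := fun _ => rfl }
  have hcardL : Nat.card (f.rootSet L) = m + 1 := by
    rw [Nat.card_eq_fintype_card, card_rootSet_eq_natDegree hsep hsL, hf,
      hmonic.natDegree_map, fR_natDegree F (m + 1) (by omega)]
  have hcardS : Nat.card ((fR F (m + 1)).rootSet S) = m + 1 := by
    rw [Nat.card_congr e, hcardL]
  have hinj : Function.Injective
      (MulAction.toPermHom (L ≃ₐ[RatFunc F] L) ((fR F (m + 1)).rootSet S)) := by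
    intro σ τ h
    have h1 : ∀ w ∈ f.rootSet L, σ w = τ w := by
      intro w hw
      have := congrArg (fun k => ((k (e.symm ⟨w, hw⟩) : (fR F (m + 1)).rootSet S) : S).1) h
      exact this
    have h3 : (σ : L →ₐ[RatFunc F] L) = τ := by
      apply AlgHom.ext_of_adjoin_eq_top (IsSplittingField.adjoin_rootSet L f)
      intro w hw
      exact h1 w hw
    ext w
    exact DFunLike.congr_fun h3 w
  obtain ⟨g, hg⟩ := exists_isSwap_aux (L ≃ₐ[RatFunc F] L) m hm hcard h2 hs hinj
  have hq : Fintype.card F - 1 = m + 1 := by omega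
  have htrans : ∀ w w' : L, w ∈ f.rootSet L → w' ∈ f.rootSet L →
      ∃ σ : L ≃ₐ[RatFunc F] L, σ w = w' := by
    intro w w' hw hw'
    rw [mem_rootSet] at hw hw'
    have e1 := minpoly.eq_of_irreducible hirr hw.2
    have e2 := minpoly.eq_of_irreducible hirr hw'.2
    obtain ⟨σ, hσ⟩ := minpoly.exists_algEquiv_of_root' (K := RatFunc F) (x := w') (y := w)
      (Algebra.IsAlgebraic.isAlgebraic w) (by rw [← e1, e2]; exact minpoly.aeval _ _)
    exact ⟨σ, hσ⟩
  have htt : ∀ a b c d : (fR F (m + 1)).rootSet S, a ≠ b → c ≠ d →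
      ∃ g : L ≃ₐ[RatFunc F] L, g • a = c ∧ g • b = d := by
    intro a b c d hab hcd
    obtain ⟨σ, hσ⟩ := htrans _ _ (e a).2 (e c).2
    have hb : e (σ • b) ≠ e c := by
      intro h
      have : (σ (e b).1) = σ (e a).1 := by rw [hσ, ← h]; rfl
      exact hab (e.injective (Subtype.ext (σ.injective this))).symm
    have hd : e d ≠ e c := fun h => hcd (e.injective h).symm
    obtain ⟨τ, h1, h3⟩ := twotrans_aux h2 (e c).1 (e (σ • b)).1 (e d).1
      (by rw [hq]; exact (hmemL _).1 (e c).2) (by rw [hq]; exact (hmemL _).1 (e _).2)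
      (by rw [hq]; exact (hmemL _).1 (e d).2) (fun h => hb (Subtype.ext h))
      (fun h => hd (Subtype.ext h))
    refine ⟨τ * σ, ?_, ?_⟩
    · apply e.injective
      apply Subtype.ext
      change τ (σ (e a).1) = (e c).1
      rw [hσ, h3]
    · apply e.injective
      apply Subtype.ext
      exact h1
  have hsurj := surj_of_twotrans htt g hg
  rw [Nat.card_congr (Equiv.ofBijective _ ⟨hinj, hsurj⟩), Nat.card_perm, hcardS]

theorem stmt_12 (p a : ℕ) [Fact p.Prime] (hodd : Odd p) (ha : 0 < a)
    (F : Type) [Field F] [Fintype F] (hF : Fintype.card F = p ^ a) :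
    Nat.card ((X : Polynomial (RatFunc F)) ^ (p ^ a - 1) + X + C (2 * RatFunc.X)).Gal
      = Nat.factorial (p ^ a - 1) := by
  have hodd' : Odd (Fintype.card F) := by rw [hF]; exact hodd.pow
  have h1 : 1 < Fintype.card F := Fintype.one_lt_card
  obtain ⟨k, hk⟩ := hodd'
  have h2 : (2 : F) ≠ 0 := by
    intro h
    have h3 := FiniteField.cast_card_eq_zero F
    rw [hk] at h3
    push_cast at h3
    rw [h, zero_mul, zero_add] at h3
    exact one_ne_zero h3
  have hm : Fintype.card F = (2 * k - 1) + 2 := by omega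
  have hq : p ^ a - 1 = (2 * k - 1) + 1 := by omega
  rw [hq, ← fK_eq]
  exact main_aux (SplittingField _) (2 * k - 1) (by omega) hm h2
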